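/- The Kolmogorov–Sinai entropy of the zip shift equals the entropy of the partition by cylinders of index 0, i.e., the Shannon entropy of p⁺: h_μ(σ) = H_μ(𝒞_0) = Σ_{s∈S⁺} −p⁺_s · log p⁺_s. -/

import Mathlib

open MeasureTheory Filter Real

namespace ZipShiftPaper

variable {Sm Sp : Type*}

/-- `s` is an admissible symbol for index `i`: a negative symbol (inl) if `i < 0`,
a positive symbol (inr) if `i ≥ 0`. -/
def Adm (i : ℤ) (s : Sm ⊕ Sp) : Prop :=
  if i < 0 then s.isLeft = true else s.isRight = true

/-- The zip shift space: bilateral sequences with positive symbols on indices `≥ 0`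
and negative symbols on indices `< 0`. -/
def ZipSpace (Sm Sp : Type*) := {x : ℤ → Sm ⊕ Sp // ∀ i, Adm i (x i)}

variable (φ : Sp → Sm)

/-- The transition function applied to a combined symbol. -/
def phiHat : Sm ⊕ Sp → Sm ⊕ Sp
  | .inl t => .inl t
  | .inr s => .inl (φ s)

lemma adm_shift (x : ZipSpace Sm Sp) (i : ℤ) :
    Adm i (if i = -1 then phiHat φ (x.1 0) else x.1 (i + 1)) := by
  by_cases h : i = -1
  · subst h
    have h0 := x.2 0
    simp only [Adm, if_neg (by norm_num : ¬ (0:ℤ) < 0)] at h0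
    simp only [if_pos rfl, Adm, if_pos (by norm_num : (-1:ℤ) < 0)]
    rcases hx : x.1 0 with t | s
    · rw [hx] at h0; simp at h0
    · simp [phiHat]
  · rw [if_neg h]
    have h1 := x.2 (i + 1)
    unfold Adm at h1 ⊢
    by_cases hi : i < 0
    · rw [if_pos hi]; rw [if_pos (by omega)] at h1; exact h1
    · rw [if_neg hi]; rw [if_neg (by omega)] at h1; exact h1

/-- The zip shift map `σ_φ`. -/
def zipShift (x : ZipSpace Sm Sp) : ZipSpace Sm Sp :=
  ⟨fun i => if i = -1 then phiHat φ (x.1 0) else x.1 (i + 1), adm_shift φ x⟩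

/-- The cylinder `C^s_i = {x : x_i = s}`. -/
def cyl (i : ℤ) (s : Sm ⊕ Sp) : Set (ZipSpace Sm Sp) := {x | x.1 i = s}

/-- The σ-algebra on the zip shift space, generated by the cylinders. -/
instance zipMS : MeasurableSpace (ZipSpace Sm Sp) :=
  .generateFrom {C | ∃ i s, C = cyl i s}

/-- The partition `𝒞_i` of `Σ` by cylinders of index `i`. -/
def cylPart (i : ℤ) : Set (Set (ZipSpace Sm Sp)) :=
  {C | ∃ s : Sm ⊕ Sp, Adm i s ∧ C = cyl i s}

/-- Forward image of a partition: `f(P) = {f(A) : A ∈ P}`. -/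
def pushPart {α : Type*} (f : α → α) (P : Set (Set α)) : Set (Set α) :=
  (Set.image f) '' P

/-- Pullback of a partition: `f⁻¹(P) = {f⁻¹(A) : A ∈ P}`. -/
def pullPart {α : Type*} (f : α → α) (P : Set (Set α)) : Set (Set α) :=
  (Set.preimage f) '' P

/-- `σ^j(P)` for `j : ℤ`: forward image for `j ≥ 0`, preimage for `j < 0`. -/
def powPart {α : Type*} (f : α → α) (j : ℤ) (P : Set (Set α)) : Set (Set α) :=
  if 0 ≤ j then pushPart (f^[j.toNat]) P else pullPart (f^[(-j).toNat]) P

/-- Common refinement (correfinement) `⋁_{i ∈ t} P i` of a family of partitions: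
all nonempty intersections of one element from each partition. -/
def corefine {α ι : Type*} (t : Set ι) (P : ι → Set (Set α)) : Set (Set α) :=
  {A | A.Nonempty ∧ ∃ g : ι → Set α, (∀ i ∈ t, g i ∈ P i) ∧ A = ⋂ i ∈ t, g i}

/-- The partition `𝒞_{n,…,n'}` by cylinders of indices from `n` to `n'`. -/
def cylRange (n n' : ℤ) : Set (Set (ZipSpace Sm Sp)) :=
  corefine (Set.Icc n n') cylPart

/-- The `k`-th dynamical correfinement `⋁_{j=0}^{k-1} f^{-j}(P)`. -/
def dynRefine {α : Type*} (f : α → α) (P : Set (Set α)) (k : ℕ) : Set (Set α) :=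
  corefine (Set.Iio k) (fun j : ℕ => pullPart (f^[j]) P)

/-- Entropy of a partition: `H_μ(P) = Σ_{A ∈ P} -μ(A) log μ(A)`. -/
noncomputable def partH {α : Type*} [MeasurableSpace α] (μ : Measure α)
    (P : Set (Set α)) : ℝ :=
  ∑' A : P, Real.negMulLog ((μ (A : Set α)).toReal)

variable (pp : Sp → ℝ) [Fintype Sp] [DecidableEq Sm]

/-- The pushforward distribution `p⁻ = φ_* p⁺` on the negative symbols. -/
def pm (t : Sm) : ℝ := ∑ s ∈ Finset.univ.filter (fun s => φ s = t), pp s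

/-- The weight of symbol `s` at coordinate `i`: `p⁺_s` for a positive symbol at `i ≥ 0`,
`p⁻_s` for a negative symbol at `i < 0`, and `0` for inadmissible pairs. -/
def wt : ℤ → Sm ⊕ Sp → ℝ
  | i, .inl t => if i < 0 then pm φ pp t else 0
  | i, .inr s => if 0 ≤ i then pp s else 0

/-- `μ` is the product measure determined by `p⁺` (coordinates independent, coordinate `i`
distributed as `p⁺` for `i ≥ 0` and as `p⁻ = φ_* p⁺` for `i < 0`). -/
def IsProductMeasure (μ : Measure (ZipSpace Sm Sp)) : Prop :=
  ∀ (F : Finset ℤ) (c : ℤ → Sm ⊕ Sp),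
    μ {x : ZipSpace Sm Sp | ∀ i ∈ F, x.1 i = c i}
      = ∏ i ∈ F, ENNReal.ofReal (wt φ pp i (c i))

/-- The fiber space `σ⁻¹(ε) = {σ⁻¹({x}) : x ∈ Σ}`: the partition of `Σ` into
preimages of points, viewed as a type. -/
def Fib (φ : Sp → Sm) := {A : Set (ZipSpace Sm Sp) // ∃ x, A = zipShift φ ⁻¹' {x}}

/-- The natural projection `π : Σ → σ⁻¹(ε)`, `π(y) = σ⁻¹({σ(y)})`. -/
def fibProj (y : ZipSpace Sm Sp) : Fib φ :=
  ⟨zipShift φ ⁻¹' {zipShift φ y}, zipShift φ y, rfl⟩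

/-- The quotient σ-algebra on `σ⁻¹(ε)`:
`Q` is measurable iff `π⁻¹(Q)` is measurable in `Σ`. -/
instance fibMS : MeasurableSpace (Fib φ) :=
  MeasurableSpace.map (fibProj φ) (zipMS)

/-- `X̂ = {x̂ : x ∈ X}`, the set of fibers of points of `X`. -/
def hatSet (X : Set (ZipSpace Sm Sp)) : Set (Fib φ) :=
  {A | ∃ x ∈ X, A.1 = zipShift φ ⁻¹' {x}}

/-- The negative symbol `x_{-1}` of a point of the zip shift space. -/
def negSym (x : ZipSpace Sm Sp) : Sm :=
  (x.1 (-1)).getLeft (by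
    have h := x.2 (-1)
    simpa [Adm, if_pos (by norm_num : (-1:ℤ) < 0)] using h)

/-- The preimage `x̂(s) = (…, x_{-2}; s, x_0, x_1, …)` of `x` under the zip shift,
determined by the choice of positive symbol `s ∈ φ⁻¹(x_{-1})` at coordinate `0`. -/
def prePoint (x : ZipSpace Sm Sp) (s : Sp) : ZipSpace Sm Sp :=
  ⟨fun j => if j = 0 then .inr s else x.1 (j - 1), by
    intro j
    dsimp only
    by_cases h : j = 0
    · subst h
      simp [Adm]
    · rw [if_neg h]
      have h1 := x.2 (j - 1)
      unfold Adm at h1 ⊢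
      by_cases hj : j < 0
      · rw [if_pos hj]; rw [if_pos (by omega)] at h1; exact h1
      · rw [if_neg hj]; rw [if_neg (by omega)] at h1; exact h1⟩

/-- The conditional measure `μ_{x̂}` on the fiber `x̂ = σ⁻¹({x})`, giving mass
`q^{x_{-1}}_s = p⁺_s / p⁻_{x_{-1}}` to the point `x̂(s)`, `s ∈ φ⁻¹(x_{-1})`. -/
noncomputable def condMeas (x : ZipSpace Sm Sp) : Measure (ZipSpace Sm Sp) :=
  ∑ s ∈ Finset.univ.filter (fun s => φ s = negSym x),
    (ENNReal.ofReal (pp s / pm φ pp (negSym x))) • Measure.dirac (prePoint x s)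

/-- The conditional measure attached to a fiber `A ∈ σ⁻¹(ε)`. -/
noncomputable def condMeasFib (A : Fib φ) : Measure (ZipSpace Sm Sp) :=
  condMeas φ pp A.2.choose

/-- The entropy `H_{μ_{x̂}}(ε|_{x̂})` of the restriction of the atomic partition to the
fiber `x̂`, with respect to the conditional measure `μ_{x̂}`. -/
noncomputable def fibH (A : Fib φ) : ℝ :=
  ∑' y : A.1,
    Real.negMulLog ((condMeasFib φ pp A {(y : ZipSpace Sm Sp)}).toReal)

/-- The folding entropy `F(σ) = ∫ H_{μ_{x̂}}(ε|_{x̂}) dμ̂(x̂)`, where `μ̂ = π_* μ` is the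
quotient measure on `σ⁻¹(ε)`. -/
noncomputable def foldH (μ : Measure (ZipSpace Sm Sp)) : ℝ :=
  ∫ A, fibH φ pp A ∂(μ.map (fibProj φ))

/-- A finite measurable partition (mod 0) of a probability space. -/
def IsFinPart {α : Type*} [MeasurableSpace α] (μ : Measure α) (P : Set (Set α)) : Prop :=
  P.Finite ∧ (∀ A ∈ P, MeasurableSet A) ∧ P.Pairwise Disjoint ∧ μ (⋃₀ P) = 1


/-- The Kolmogorov–Sinai entropy: the supremum, over all finite measurable partitions `P`,
of the limits `h_μ(f, P) = lim_n H_μ(⋁_{j=0}^{n-1} f^{-j}P)/n`. -/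
noncomputable def ksEntropy {α : Type*} [MeasurableSpace α] (μ : Measure α) (f : α → α) : ℝ :=
  sSup {h : ℝ | ∃ P : Set (Set α), IsFinPart μ P ∧
    Tendsto (fun n : ℕ => partH μ (dynRefine f P n) / n) atTop (nhds h)}


end ZipShiftPaper

namespace ZipShiftPaper

section FiniteEntropy

variable {α κ : Type*} [MeasurableSpace α]

/-- Shannon entropy of a random variable with finitely many values. -/
noncomputable def varH [Fintype κ] (μ : Measure α) (W : α → κ) : ℝ :=
  ∑ w, negMulLog (μ.real (W ⁻¹' {w}))

lemma negMulLog_sum_le {ι : Type*} (s : Finset ι) (p : ι → ℝ) (hp : ∀ i ∈ s, 0 ≤ p i) :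
    negMulLog (∑ i ∈ s, p i) ≤ ∑ i ∈ s, negMulLog (p i) := by
  have h : negMulLog (∑ i ∈ s, p i) = ∑ i ∈ s, p i * -log (∑ j ∈ s, p j) := by
    rw [← Finset.sum_mul, negMulLog]; ring
  rw [h]
  refine Finset.sum_le_sum fun i hi => ?_
  rcases (hp i hi).eq_or_lt with h0 | h0
  · simp [← h0]
  · have hle := Real.log_le_log h0 (Finset.single_le_sum hp hi)
    rw [negMulLog]
    nlinarith

/-- Gibbs' inequality. -/
lemma sum_negMulLog_le_crossEntropy [Fintype κ] (p q : κ → ℝ) (hp : ∀ w, 0 ≤ p w)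
    (hq : ∀ w, 0 ≤ q w) (hp1 : ∑ w, p w = 1) (hq1 : ∑ w, q w ≤ 1)
    (hpq : ∀ w, q w = 0 → p w = 0) :
    ∑ w, negMulLog (p w) ≤ ∑ w, p w * -log (q w) := by
  have key : ∀ w, negMulLog (p w) ≤ p w * -log (q w) + (q w - p w) := by
    intro w
    rcases (hp w).eq_or_lt with h0 | h0
    · simp [← h0, hq w]
    · have hqw : 0 < q w := (hq w).lt_of_ne' fun h => h0.ne' (hpq w h)
      have h1 := Real.log_le_sub_one_of_pos (div_pos hqw h0)
      rw [Real.log_div hqw.ne' h0.ne'] at h1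
      have h2 := mul_le_mul_of_nonneg_left h1 h0.le
      have h3 : p w * (q w / p w - 1) = q w - p w := by field_simp
      rw [negMulLog]
      linarith
  calc _ ≤ ∑ w, (p w * -log (q w) + (q w - p w)) := Finset.sum_le_sum fun w _ => key w
    _ ≤ _ := by rw [Finset.sum_add_distrib, Finset.sum_sub_distrib]; linarith

lemma integrable_comp_of_finite [Finite κ] (μ : Measure α) [IsFiniteMeasure μ] {W : α → κ}
    (hW : ∀ w, MeasurableSet (W ⁻¹' {w})) (g : κ → ℝ) : Integrable (fun x => g (W x)) μ := by
  let _ : MeasurableSpace κ := ⊤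
  have : MeasurableSingletonClass κ := ⟨fun _ => trivial⟩
  have hWm : Measurable W := measurable_to_countable' hW
  exact (Integrable.of_finite (μ := μ.map W) (f := g)).comp_measurable hWm

lemma integral_comp_eq_sum [Fintype κ] (μ : Measure α) [IsFiniteMeasure μ] {W : α → κ}
    (hW : ∀ w, MeasurableSet (W ⁻¹' {w})) (g : κ → ℝ) :
    ∫ x, g (W x) ∂μ = ∑ w, μ.real (W ⁻¹' {w}) * g w := by
  let _ : MeasurableSpace κ := ⊤
  have : MeasurableSingletonClass κ := ⟨fun _ => trivial⟩
  have hWm : Measurable W := measurable_to_countable' hW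
  rw [← integral_map (f := g) hWm.aemeasurable
    (Integrable.of_finite (μ := μ.map W)).aestronglyMeasurable,
    integral_fintype Integrable.of_finite]
  refine Finset.sum_congr rfl fun w _ => ?_
  rw [map_measureReal_apply hWm (measurableSet_singleton w), smul_eq_mul]

lemma sum_measureReal_fiber [Fintype κ] (μ : Measure α) [IsProbabilityMeasure μ] {W : α → κ}
    (hW : ∀ w, MeasurableSet (W ⁻¹' {w})) : ∑ w, μ.real (W ⁻¹' {w}) = 1 := by
  simpa using (integral_comp_eq_sum μ hW fun _ => (1 : ℝ)).symm

lemma varH_eq_integral [Fintype κ] (μ : Measure α) [IsFiniteMeasure μ] {W : α → κ}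
    (hW : ∀ w, MeasurableSet (W ⁻¹' {w})) :
    varH μ W = ∫ x, -log (μ.real (W ⁻¹' {W x})) ∂μ := by
  rw [integral_comp_eq_sum μ hW fun w => -log (μ.real (W ⁻¹' {w}))]
  exact Finset.sum_congr rfl fun w _ => by rw [negMulLog]; ring

/-- A disjoint family of unions of fibres of `W` has entropy at most that of `W`. -/
lemma partH_le_varH [Fintype κ] (μ : Measure α) [IsProbabilityMeasure μ] {W : α → κ}
    (hW : ∀ w, MeasurableSet (W ⁻¹' {w})) {D : Set (Set α)} (hD : D.Pairwise Disjoint)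
    (hDW : ∀ A ∈ D, ∀ x y, W x = W y → x ∈ A → y ∈ A) : partH μ D ≤ varH μ W := by
  classical
  have hpre : ∀ A ∈ D, W ⁻¹' (W '' A) = A := fun A hA =>
    Set.Subset.antisymm (fun y ⟨x, hx, hxy⟩ => hDW A hA x y hxy hx) (Set.subset_preimage_image _ _)
  have hfin : D.Finite :=
    (Set.finite_range (Set.preimage W)).subset fun A hA => ⟨_, hpre A hA⟩
  have := hfin.fintype
  set T : D → Finset κ := fun A => (W '' (A : Set α)).toFinite.toFinset with hT
  have hmem : ∀ (A : D) w, w ∈ T A ↔ w ∈ W '' (A : Set α) := fun A w => by simp [hT]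
  have hA : ∀ A : D, μ.real (A : Set α) = ∑ w ∈ T A, μ.real (W ⁻¹' {w}) := by
    intro A
    rw [sum_measureReal_preimage_singleton _ (fun w _ => hW w)]
    congr 1
    rw [hT]; simp [hpre A A.2]
  have hdisj : Set.PairwiseDisjoint (↑(Finset.univ : Finset D)) T := by
    intro A _ B _ hAB
    refine Finset.disjoint_left.2 fun w hwA hwB => ?_
    obtain ⟨x, hx, rfl⟩ := (hmem A w).1 hwA
    obtain ⟨y, hy, hxy⟩ := (hmem B _).1 hwB
    exact Set.disjoint_left.1 (hD A.2 B.2 fun h => hAB (Subtype.ext h)) hx (hDW B B.2 y x hxy hy)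
  calc partH μ D = ∑ A : D, negMulLog (μ.real (A : Set α)) := tsum_fintype _
    _ ≤ ∑ A : D, ∑ w ∈ T A, negMulLog (μ.real (W ⁻¹' {w})) := Finset.sum_le_sum fun A _ => by
        rw [hA A]; exact negMulLog_sum_le _ _ fun _ _ => measureReal_nonneg
    _ = ∑ w ∈ Finset.univ.biUnion T, negMulLog (μ.real (W ⁻¹' {w})) :=
        (Finset.sum_biUnion hdisj).symm
    _ ≤ varH μ W := Finset.sum_le_sum_of_subset_of_nonneg (Finset.subset_univ _) fun w _ _ =>
        negMulLog_nonneg measureReal_nonneg measureReal_le_one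

/-- The partition into fibres of `W` has the entropy of `W`. -/
lemma partH_eq_varH [Fintype κ] (μ : Measure α) {W : α → κ} {D : Set (Set α)}
    (hDW : ∀ A ∈ D, ∃ w, A = W ⁻¹' {w}) (hWD : ∀ x, W ⁻¹' {W x} ∈ D) :
    partH μ D = varH μ W := by
  classical
  have hfin : D.Finite :=
    (Set.finite_range fun w => W ⁻¹' {w}).subset fun A hA => by
      obtain ⟨w, rfl⟩ := hDW A hA; exact ⟨w, rfl⟩
  have h1 : partH μ D = ∑ A ∈ hfin.toFinset, negMulLog (μ.real A) := by
    rw [partH, ← Finset.tsum_subtype' hfin.toFinset fun A => negMulLog (μ.real A)]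
    rw [hfin.coe_toFinset]; rfl
  have hinj : Set.InjOn (fun w => W ⁻¹' {w}) ↑(Finset.univ.filter fun w => w ∈ Set.range W) := by
    intro v hv w _ hvw
    obtain ⟨x, rfl⟩ := (Finset.mem_filter.1 hv).2
    have : x ∈ W ⁻¹' {w} := by rw [← (show W ⁻¹' {W x} = W ⁻¹' {w} from hvw)]; rfl
    exact this
  rw [h1, varH, ← Finset.sum_subset (Finset.filter_subset (fun w => w ∈ Set.range W) _),
    ← Finset.sum_image (f := fun A => negMulLog (μ.real A)) hinj]
  · refine (Finset.sum_subset ?_ ?_).symm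
    · intro A hA
      obtain ⟨w, hw, rfl⟩ := Finset.mem_image.1 hA
      obtain ⟨x, rfl⟩ := (Finset.mem_filter.1 hw).2
      simpa using hWD x
    · intro A hA hA'
      obtain ⟨w, rfl⟩ := hDW A (by simpa using hA)
      have : W ⁻¹' {w} = ∅ := Set.eq_empty_of_forall_notMem fun x hx =>
        hA' (Finset.mem_image.2 ⟨w, Finset.mem_filter.2 ⟨Finset.mem_univ _, x, hx⟩, rfl⟩)
      simp [this]
  · intro w _ hw
    have : W ⁻¹' {w} = ∅ := Set.eq_empty_of_forall_notMem fun x hx =>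
      hw (Finset.mem_filter.2 ⟨Finset.mem_univ _, x, hx⟩)
    simp [this]

/-- A Fano-type inequality: variables `X j` that are well predicted by functions `y j` of `Z`
add little entropy to that of `Z`. -/
lemma varH_prod_le {ζ L J : Type*} [Fintype ζ] [Fintype L] [Fintype J] [Nonempty L]
    [DecidableEq L] [DecidableEq J]
    (μ : Measure α) [IsProbabilityMeasure μ] {Z : α → ζ} (hZ : ∀ z, MeasurableSet (Z ⁻¹' {z}))
    {X : J → α → L} (hX : ∀ j l, MeasurableSet (X j ⁻¹' {l})) (y : J → ζ → L)
    {η : ℝ} (h0 : 0 < η) (h1 : η < 1) :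
    varH μ (fun x => (Z x, fun j => X j x)) ≤ varH μ Z +
      ∑ j, (-log (1 - η) + μ.real {x | X j x ≠ y j (Z x)} * log (Fintype.card L / η)) := by
  set K : ℝ := (Fintype.card L : ℝ)
  have hK : 1 ≤ K := Nat.one_le_cast.2 Fintype.card_pos
  set k : L → L → ℝ := fun a b => if a = b then 1 - η else η / K
  have hk : ∀ a b, 0 < k a b := fun a b => by
    simp only [k]; split_ifs
    · linarith
    · positivity
  have hksum : ∀ b, ∑ a, k a b ≤ 1 := fun b => by
    calc ∑ a, k a b ≤ ∑ a, ((if a = b then 1 - η else 0) + η / K) :=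
          Finset.sum_le_sum fun a _ => by
            simp only [k]; split_ifs
            · have : 0 ≤ η / K := by positivity
              linarith
            · linarith
      _ = 1 := by
          rw [Finset.sum_add_distrib]
          simp only [Finset.sum_ite_eq', Finset.mem_univ, if_true, Finset.sum_const,
            Finset.card_univ, nsmul_eq_mul]
          change 1 - η + K * (η / K) = 1
          field_simp; ring
  have hlk : ∀ a b, -log (k a b) ≤ -log (1 - η) + (if a ≠ b then 1 else 0) * log (K / η) := by
    intro a b
    by_cases hab : a = b
    · simp [k, hab]
    · have : log (1 - η) ≤ 0 := Real.log_nonpos (by linarith) (by linarith)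
      simp only [k, hab, if_false, ne_eq, not_false_eq_true, if_true, one_mul]
      rw [← Real.log_inv, inv_div]
      linarith
  set W : α → ζ × (J → L) := fun x => (Z x, fun j => X j x) with hWdef
  have hW : ∀ w, MeasurableSet (W ⁻¹' {w}) := by
    rintro ⟨z, l⟩
    have : W ⁻¹' {(z, l)} = Z ⁻¹' {z} ∩ ⋂ j, X j ⁻¹' {l j} := by
      ext x; simp [hWdef, funext_iff]
    rw [this]
    exact (hZ z).inter (MeasurableSet.iInter fun j => hX j _)
  set r : ζ → ℝ := fun z => μ.real (Z ⁻¹' {z})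
  set q : ζ × (J → L) → ℝ := fun w => r w.1 * ∏ j, k (w.2 j) (y j w.1)
  have hprod : ∀ w : ζ × (J → L), 0 < ∏ j, k (w.2 j) (y j w.1) := fun w =>
    Finset.prod_pos fun j _ => hk _ _
  have hr0 : ∀ w, r w.1 = 0 → μ.real (W ⁻¹' {w}) = 0 := fun w hw =>
    le_antisymm (hw ▸ measureReal_mono fun x hx => by
      have : W x = w := hx
      simp [← this, hWdef]) measureReal_nonneg
  have hq1 : ∑ w, q w ≤ 1 := by
    rw [Fintype.sum_prod_type]
    calc ∑ z, ∑ l : J → L, r z * ∏ j, k (l j) (y j z)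
        = ∑ z, r z * ∏ j, ∑ a, k a (y j z) := by
          refine Finset.sum_congr rfl fun z _ => ?_
          rw [← Finset.mul_sum, Fintype.prod_sum]
      _ ≤ ∑ z, r z * 1 := Finset.sum_le_sum fun z _ =>
          mul_le_mul_of_nonneg_left (Finset.prod_le_one
            (fun j _ => Finset.sum_nonneg fun a _ => (hk _ _).le) fun j _ => hksum _)
            measureReal_nonneg
      _ = 1 := by simpa using sum_measureReal_fiber μ hZ
  have hgibbs := sum_negMulLog_le_crossEntropy (fun w => μ.real (W ⁻¹' {w})) q
    (fun w => measureReal_nonneg) (fun w => mul_nonneg measureReal_nonneg (hprod w).le)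
    (sum_measureReal_fiber μ hW) hq1
    (fun w hw => hr0 w ((mul_eq_zero.1 hw).resolve_right (hprod w).ne'))
  have hE : ∀ j, MeasurableSet {x | X j x ≠ y j (Z x)} := fun j => by
    have : {x | X j x ≠ y j (Z x)} = ⋃ z, Z ⁻¹' {z} ∩ (X j ⁻¹' {y j z})ᶜ := by
      ext x; simp
    rw [this]
    exact MeasurableSet.iUnion fun z => (hZ z).inter (hX j _).compl
  have hint : ∀ j, Integrable (fun x => -log (1 - η) +
      (if X j x ≠ y j (Z x) then 1 else 0) * log (K / η)) μ := fun j =>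
    integrable_comp_of_finite μ hW
      fun w => -log (1 - η) + (if w.2 j ≠ y j w.1 then 1 else 0) * log (K / η)
  have hintZ : Integrable (fun x => -log (r (Z x))) μ :=
    integrable_comp_of_finite μ hZ fun z => -log (r z)
  calc varH μ W ≤ ∑ w, μ.real (W ⁻¹' {w}) * -log (q w) := hgibbs
    _ ≤ ∑ w, μ.real (W ⁻¹' {w}) * (-log (r w.1) +
          ∑ j, (-log (1 - η) + (if w.2 j ≠ y j w.1 then 1 else 0) * log (K / η))) := by
        refine Finset.sum_le_sum fun w _ => ?_
        by_cases hr : r w.1 = 0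
        · simp [hr0 w hr]
        · refine mul_le_mul_of_nonneg_left ?_ measureReal_nonneg
          rw [Real.log_mul hr (hprod w).ne', Real.log_prod fun j _ => (hk _ _).ne', neg_add,
            ← Finset.sum_neg_distrib]
          gcongr with j
          exact hlk _ _
    _ = ∫ x, (-log (r (Z x)) +
          ∑ j, (-log (1 - η) + (if X j x ≠ y j (Z x) then 1 else 0) * log (K / η))) ∂μ :=
        (integral_comp_eq_sum μ hW fun w => -log (r w.1) +
          ∑ j, (-log (1 - η) + (if w.2 j ≠ y j w.1 then 1 else 0) * log (K / η))).symm
    _ = _ := by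
        rw [integral_add hintZ (integrable_finsetSum _ fun j _ => hint j),
          integral_finsetSum _ fun j _ => hint j, varH_eq_integral μ hZ]
        congr 1
        refine Finset.sum_congr rfl fun j _ => ?_
        rw [integral_add (integrable_const _), integral_const, integral_mul_const]
        · have : (fun x => if X j x ≠ y j (Z x) then (1 : ℝ) else 0) =
              {x | X j x ≠ y j (Z x)}.indicator 1 := by
            ext x; simp [Set.indicator_apply]
          rw [this, integral_indicator_one (hE j)]
          simp
        · exact integrable_comp_of_finite μ hW fun w => (if w.2 j ≠ y j w.1 then 1 else 0) * log (K / η)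

end FiniteEntropy

section Refinement

variable {α : Type*} (f : α → α) {P : Set (Set α)}

lemma pairwise_disjoint_dynRefine (hP : P.Pairwise Disjoint) (n : ℕ) :
    (dynRefine f P n).Pairwise Disjoint := by
  rintro _ ⟨-, g, hg, rfl⟩ _ ⟨-, g', hg', rfl⟩ hne
  refine Set.disjoint_left.2 fun x hx hx' => hne ?_
  refine Set.iInter₂_congr fun j hj => ?_
  obtain ⟨B, hB, hBg⟩ := hg j hj
  obtain ⟨B', hB', hBg'⟩ := hg' j hj
  have h1 : f^[j] x ∈ B := by simpa [← hBg] using Set.mem_iInter₂.1 hx j hj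
  have h2 : f^[j] x ∈ B' := by simpa [← hBg'] using Set.mem_iInter₂.1 hx' j hj
  have : B = B' := by
    by_contra h
    exact Set.disjoint_left.1 (hP hB hB' h) h1 h2
  rw [← hBg, ← hBg', this]

lemma mem_of_mem_dynRefine {n : ℕ} {A : Set α} (hA : A ∈ dynRefine f P n) {x y : α}
    (hxy : ∀ j < n, {B : P | f^[j] x ∈ (B : Set α)} = {B : P | f^[j] y ∈ (B : Set α)})
    (hx : x ∈ A) : y ∈ A := by
  obtain ⟨-, g, hg, rfl⟩ := hA
  refine Set.mem_iInter₂.2 fun j hj => ?_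
  obtain ⟨B, hB, hBg⟩ := hg j hj
  have h1 : f^[j] x ∈ B := by simpa [← hBg] using Set.mem_iInter₂.1 hx j hj
  have h2 : (⟨B, hB⟩ : P) ∈ {B : P | f^[j] x ∈ (B : Set α)} := h1
  rw [hxy j hj] at h2
  rw [← hBg]
  exact h2

end Refinement

section Zip

variable {Sm Sp : Type*}

/-- The coordinates of a point with indices in `I`. -/
def window (I : Finset ℤ) (x : ZipSpace Sm Sp) : I → Sm ⊕ Sp := fun i => x.1 i

lemma measurableSet_cyl (i : ℤ) (s : Sm ⊕ Sp) : MeasurableSet (cyl i s) :=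
  MeasurableSpace.measurableSet_generateFrom ⟨i, s, rfl⟩

lemma cyl_disjoint {i : ℤ} {s t : Sm ⊕ Sp} (h : s ≠ t) : Disjoint (cyl i s) (cyl i t) :=
  Set.disjoint_left.2 fun _ hs ht => h (Eq.trans (Eq.symm hs) ht)

lemma measurableSet_eqOn (F : Finset ℤ) (c : ℤ → Sm ⊕ Sp) :
    MeasurableSet {x : ZipSpace Sm Sp | ∀ i ∈ F, x.1 i = c i} := by
  have : {x : ZipSpace Sm Sp | ∀ i ∈ F, x.1 i = c i} = ⋂ i ∈ F, cyl i (c i) := by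
    ext x; simp [cyl]
  rw [this]
  exact Finset.measurableSet_biInter F fun i _ => measurableSet_cyl _ _

lemma window_preimage_singleton [Nonempty (Sm ⊕ Sp)] (I : Finset ℤ) (z : I → Sm ⊕ Sp) :
    ∃ c : ℤ → Sm ⊕ Sp, (∀ i : I, c i = z i) ∧
      window I ⁻¹' {z} = {x : ZipSpace Sm Sp | ∀ i ∈ I, x.1 i = c i} := by
  classical
  refine ⟨fun i => if h : i ∈ I then z ⟨i, h⟩ else Classical.arbitrary _, fun i => by simp, ?_⟩
  ext x
  simp only [Set.mem_preimage, Set.mem_singleton_iff, funext_iff, Subtype.forall, window,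
    Set.mem_ofPred_eq]
  exact forall₂_congr fun i hi => by simp [hi]

lemma measurableSet_window_fiber [Nonempty (Sm ⊕ Sp)] (I : Finset ℤ) (z : I → Sm ⊕ Sp) :
    MeasurableSet (window I ⁻¹' {z} : Set (ZipSpace Sm Sp)) := by
  obtain ⟨c, -, h⟩ := window_preimage_singleton I z
  rw [h]
  exact measurableSet_eqOn I c

lemma isPiSystem_eqOn : IsPiSystem {A : Set (ZipSpace Sm Sp) |
    ∃ (F : Finset ℤ) (c : ℤ → Sm ⊕ Sp), A = {x | ∀ i ∈ F, x.1 i = c i}} := by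
  rintro _ ⟨F, c, rfl⟩ _ ⟨G, d, rfl⟩ ⟨x, hx, hx'⟩
  refine ⟨F ∪ G, x.1, ?_⟩
  ext y
  simp only [Set.mem_inter_iff, Set.mem_ofPred_eq, Finset.mem_union] at hx hx' ⊢
  constructor
  · rintro ⟨h, h'⟩ i (hi | hi)
    · rw [h i hi, hx i hi]
    · rw [h' i hi, hx' i hi]
  · intro h
    exact ⟨fun i hi => by rw [h i (.inl hi), hx i hi], fun i hi => by rw [h i (.inr hi), hx' i hi]⟩

lemma zipMS_eq_generateFrom_eqOn : (zipMS : MeasurableSpace (ZipSpace Sm Sp)) =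
    .generateFrom {A | ∃ (F : Finset ℤ) (c : ℤ → Sm ⊕ Sp), A = {x | ∀ i ∈ F, x.1 i = c i}} := by
  apply le_antisymm
  · refine MeasurableSpace.generateFrom_mono ?_
    rintro _ ⟨i, s, rfl⟩
    exact ⟨{i}, fun _ => s, by simp [cyl]⟩
  · refine MeasurableSpace.generateFrom_le ?_
    rintro _ ⟨F, c, rfl⟩
    exact measurableSet_eqOn F c

/-- Measurable sets determined by finitely many coordinates. -/
def finiteCoordSets (Sm Sp : Type*) : Set (Set (ZipSpace Sm Sp)) :=
  {B | MeasurableSet B ∧ ∃ F : Finset ℤ,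
    ∀ x y : ZipSpace Sm Sp, (∀ i ∈ F, x.1 i = y.1 i) → (x ∈ B ↔ y ∈ B)}

lemma isSetAlgebra_finiteCoordSets : IsSetAlgebra (finiteCoordSets Sm Sp) where
  empty_mem := ⟨.empty, ∅, by simp⟩
  compl_mem := fun _ ⟨hm, F, hF⟩ => ⟨hm.compl, F, fun x y h => not_congr (hF x y h)⟩
  union_mem := fun _ _ ⟨hm, F, hF⟩ ⟨hm', G, hG⟩ => ⟨hm.union hm', F ∪ G, fun x y h => or_congr
    (hF x y fun i hi => h i (Finset.mem_union_left _ hi))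
    (hG x y fun i hi => h i (Finset.mem_union_right _ hi))⟩

lemma zipMS_eq_generateFrom_finiteCoordSets : (zipMS : MeasurableSpace (ZipSpace Sm Sp)) =
    .generateFrom (finiteCoordSets Sm Sp) := by
  apply le_antisymm
  · refine MeasurableSpace.generateFrom_mono ?_
    rintro _ ⟨i, s, rfl⟩
    exact ⟨measurableSet_cyl i s, {i}, fun x y h => by simp [cyl, h i (by simp)]⟩
  · exact MeasurableSpace.generateFrom_le fun B hB => hB.1

/-- Membership in the sets of a finite family is predicted, up to small probability, by
finitely many coordinates. -/
lemma exists_finiteCoord_approx (μ : Measure (ZipSpace Sm Sp)) [IsFiniteMeasure μ]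
    {P : Set (Set (ZipSpace Sm Sp))} (hfin : P.Finite) (hP : ∀ A ∈ P, MeasurableSet A)
    {δ : ℝ} (hδ : 0 < δ) :
    ∃ (m : ℕ) (Y : ZipSpace Sm Sp → Set P) (E : Set (ZipSpace Sm Sp)),
      (∀ x y, (∀ i ∈ Finset.Icc (-m : ℤ) m, x.1 i = y.1 i) → Y x = Y y) ∧
      MeasurableSet E ∧ μ.real E ≤ δ ∧ ∀ x ∉ E, {A : P | x ∈ (A : Set _)} = Y x := by
  classical
  have := hfin.fintype
  set N : ℝ := (Fintype.card P : ℝ) + 1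
  have hN : 0 < N := by positivity
  have hex : ∀ A : P, ∃ B ∈ finiteCoordSets Sm Sp,
      μ (symmDiff B (A : Set _)) < ENNReal.ofReal (δ / N) := fun A =>
    exists_measure_symmDiff_lt_of_generateFrom_isSetRing isSetAlgebra_finiteCoordSets.isSetRing
      ⟨{Set.univ}, Set.countable_singleton _,
        by simpa using isSetAlgebra_finiteCoordSets.univ_mem, by simp⟩
      zipMS_eq_generateFrom_finiteCoordSets (hP A A.2) (by simpa using div_pos hδ hN)
  choose B hB hBA using hex
  choose hBm F hF using hB
  refine ⟨(Finset.univ.biUnion F).sup Int.natAbs, fun x => {A | x ∈ B A},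
    ⋃ A : P, symmDiff (B A) (A : Set _), ?_, ?_, ?_, ?_⟩
  · intro x y hxy
    ext A
    refine hF A x y fun i hi => hxy i ?_
    have : i.natAbs ≤ (Finset.univ.biUnion F).sup Int.natAbs :=
      Finset.le_sup (f := Int.natAbs) (Finset.mem_biUnion.2 ⟨A, Finset.mem_univ _, hi⟩)
    rw [Finset.mem_Icc]
    omega
  · exact MeasurableSet.iUnion fun A => (hBm A).symmDiff (hP A A.2)
  · calc μ.real (⋃ A : P, symmDiff (B A) (A : Set _))
        ≤ ∑ A : P, μ.real (symmDiff (B A) (A : Set _)) := measureReal_iUnion_fintype_le _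
      _ ≤ ∑ _A : P, δ / N := Finset.sum_le_sum fun A _ =>
          ENNReal.toReal_le_of_le_ofReal (by positivity) (hBA A).le
      _ = (N - 1) * (δ / N) := by simp [N]
      _ ≤ δ := by
          have h : N * (δ / N) = δ := by field_simp
          have : 0 < δ / N := by positivity
          linarith
  · intro x hx
    ext A
    have h := fun h => hx (Set.mem_iUnion.2 ⟨A, h⟩)
    simp only [Set.mem_symmDiff] at h
    simp only [Set.mem_ofPred_eq]
    tauto

variable (φ : Sp → Sm)

lemma zipShift_apply (x : ZipSpace Sm Sp) (i : ℤ) :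
    (zipShift φ x).1 i = if i = -1 then phiHat φ (x.1 0) else x.1 (i + 1) := rfl

lemma zipShift_iterate_congr (j : ℕ) {x y : ZipSpace Sm Sp} {i : ℤ}
    (h : x.1 (i + j) = y.1 (i + j)) : ((zipShift φ)^[j] x).1 i = ((zipShift φ)^[j] y).1 i := by
  induction j generalizing x y with
  | zero => simpa using h
  | succ j ih =>
    refine ih ?_
    rw [zipShift_apply, zipShift_apply]
    have hij : i + ((j + 1 : ℕ) : ℤ) = i + j + 1 := by push_cast; ring
    rw [hij] at h
    split_ifs with hi
    · rw [hi, neg_add_cancel] at h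
      rw [h]
    · exact h

lemma zipShift_iterate_apply_zero (j : ℕ) (x : ZipSpace Sm Sp) :
    ((zipShift φ)^[j] x).1 0 = x.1 j := by
  have key : ∀ k : ℕ, ((zipShift φ)^[j] x).1 k = x.1 (k + j) := by
    induction j generalizing x with
    | zero => simp
    | succ j ih =>
      intro k
      rw [Function.iterate_succ_apply, ih]
      simp only [zipShift]
      rw [if_neg (by omega)]
      push_cast
      rw [add_assoc]
  simpa using key 0

lemma measurable_zipShift [Finite Sm] [Finite Sp] :
    Measurable (zipShift φ : ZipSpace Sm Sp → ZipSpace Sm Sp) := by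
  refine measurable_generateFrom ?_
  rintro _ ⟨i, s, rfl⟩
  by_cases hi : i = -1
  · have : zipShift φ ⁻¹' cyl i s = ⋃ t ∈ {t | phiHat φ t = s}, cyl 0 t := by
      ext x; simp [cyl, zipShift, hi]
    rw [this]
    exact MeasurableSet.biUnion (Set.to_countable _) fun t _ => measurableSet_cyl 0 t
  · have : zipShift φ ⁻¹' cyl i s = cyl (i + 1) s := by
      ext x; simp [cyl, zipShift, hi]
    rw [this]
    exact measurableSet_cyl _ s

variable [Fintype Sp] [DecidableEq Sm] (pp : Sp → ℝ)

lemma wt_add_one {i : ℤ} (hi : i ≠ -1) (s : Sm ⊕ Sp) : wt φ pp (i + 1) s = wt φ pp i s := by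
  rcases s with t | s
  · simp only [wt, show i + 1 < 0 ↔ i < 0 by omega]
  · simp only [wt, show 0 ≤ i + 1 ↔ 0 ≤ i by omega]

variable {pp}

lemma wt_nonneg (hpp : ∀ s, 0 ≤ pp s) (i : ℤ) (s : Sm ⊕ Sp) : 0 ≤ wt φ pp i s := by
  rcases s with t | s <;> simp only [wt] <;> split_ifs
  · exact Finset.sum_nonneg fun s _ => hpp s
  · rfl
  · exact hpp s
  · rfl

lemma sum_wt_zero_fiber [Fintype Sm] [DecidableEq (Sm ⊕ Sp)] (s : Sm ⊕ Sp) :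
    ∑ t with phiHat φ t = s, wt φ pp 0 t = wt φ pp (-1) s := by
  rw [Finset.sum_filter, Fintype.sum_sum_type]
  rcases s with u | v
  · simp [phiHat, wt, pm, Finset.sum_filter]
  · simp [phiHat, wt]

variable {μ : Measure (ZipSpace Sm Sp)}

lemma IsProductMeasure.isProbabilityMeasure (hμ : IsProductMeasure φ pp μ) [Nonempty (Sm ⊕ Sp)] :
    IsProbabilityMeasure μ :=
  ⟨by simpa using hμ ∅ fun _ => Classical.arbitrary _⟩

lemma IsProductMeasure.measurePreserving [Fintype Sm] [Nonempty (Sm ⊕ Sp)]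
    (hpp : ∀ s, 0 ≤ pp s) (hμ : IsProductMeasure φ pp μ) :
    MeasurePreserving (zipShift φ) μ μ := by
  classical
  have := hμ.isProbabilityMeasure
  refine ⟨measurable_zipShift φ, ?_⟩
  refine (ext_of_generate_finite _ zipMS_eq_generateFrom_eqOn isPiSystem_eqOn ?_ ?_).symm
  swap
  · rw [Measure.map_apply (measurable_zipShift φ) .univ, Set.preimage_univ]
  rintro _ ⟨F, c, rfl⟩
  rw [Measure.map_apply (measurable_zipShift φ) (measurableSet_eqOn F c), hμ]
  set e : ℤ ↪ ℤ := ⟨fun i => i + 1, add_left_injective 1⟩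
  by_cases hF : -1 ∈ F
  · have hset : zipShift φ ⁻¹' {x : ZipSpace Sm Sp | ∀ i ∈ F, x.1 i = c i} =
        ⋃ t ∈ Finset.univ.filter fun t => phiHat φ t = c (-1), {x | ∀ i ∈ F.map e,
          x.1 i = if i = 0 then t else c (i - 1)} := by
      ext x
      simp only [Set.mem_preimage, Finset.mem_filter, Finset.mem_univ, true_and, Set.mem_iUnion,
        exists_prop]
      constructor
      · intro h
        refine ⟨x.1 0, by simpa [zipShift_apply] using h (-1) hF, ?_⟩
        refine Finset.forall_mem_map.2 fun i hi => ?_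
        have := h i hi
        rw [zipShift_apply] at this
        by_cases h1 : i = -1
        · simp [e, h1]
        · rw [if_neg h1] at this
          have h2 : i + 1 ≠ 0 := by omega
          simpa [e, h2] using this
      · rintro ⟨t, ht, h⟩ i hi
        have := Finset.forall_mem_map.1 h i hi
        rw [zipShift_apply]
        by_cases h1 : i = -1
        · subst h1
          simp only [e, Function.Embedding.coeFn_mk, neg_add_cancel, if_true] at this
          rw [if_pos rfl, this, ht]
        · have h2 : i + 1 ≠ 0 := by omega
          rw [if_neg h1]
          simpa [e, h2] using this
    have hterm : ∀ t, μ {x : ZipSpace Sm Sp | ∀ i ∈ F.map e,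
          x.1 i = if i = 0 then t else c (i - 1)} =
        ENNReal.ofReal (wt φ pp 0 t) * ∏ i ∈ F.erase (-1), ENNReal.ofReal (wt φ pp i (c i)) := by
      intro t
      rw [hμ, Finset.prod_map, ← Finset.mul_prod_erase _ _ hF]
      congr 1
      refine Finset.prod_congr rfl fun i hi => ?_
      have hi' := Finset.ne_of_mem_erase hi
      have : i + 1 ≠ 0 := by omega
      simp [e, this, wt_add_one φ pp hi']
    rw [hset, measure_biUnion_finset, Finset.sum_congr rfl fun t _ => hterm t, ← Finset.sum_mul,
      ← ENNReal.ofReal_sum_of_nonneg fun t _ => wt_nonneg φ hpp 0 t, sum_wt_zero_fiber,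
      Finset.mul_prod_erase F (fun i => ENNReal.ofReal (wt φ pp i (c i))) hF]
    · intro t _ t' _ htt'
      refine Set.disjoint_left.2 fun x hx hx' => htt' ?_
      have h0 : (0 : ℤ) ∈ F.map e := Finset.mem_map.2 ⟨-1, hF, rfl⟩
      have h1 := hx 0 h0
      have h2 := hx' 0 h0
      simp only [if_true] at h1 h2
      rw [← h1, ← h2]
    · exact fun t _ => measurableSet_eqOn _ _
  · have hset : zipShift φ ⁻¹' {x : ZipSpace Sm Sp | ∀ i ∈ F, x.1 i = c i} =
        {x | ∀ i ∈ F.map e, x.1 i = c (i - 1)} := by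
      ext x
      have key : ∀ i ∈ F, (zipShift φ x).1 i = x.1 (i + 1) := fun i hi => by
        rw [zipShift_apply, if_neg (by rintro rfl; exact hF hi)]
      constructor
      · refine fun h => Finset.forall_mem_map.2 fun i hi => ?_
        have := h i hi
        rw [key i hi] at this
        simpa [e] using this
      · intro h i hi
        rw [key i hi]
        simpa [e] using Finset.forall_mem_map.1 h i hi
    rw [hset, hμ, Finset.prod_map]
    refine Finset.prod_congr rfl fun i hi => ?_
    have hi' : i ≠ -1 := by rintro rfl; exact hF hi
    simp [e, wt_add_one φ pp hi']

variable (pp) in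
/-- Shannon entropy of the distribution of the coordinate `i`. -/
noncomputable def coordH [Fintype Sm] (i : ℤ) : ℝ := ∑ s : Sm ⊕ Sp, negMulLog (wt φ pp i s)

lemma coordH_of_nonneg [Fintype Sm] {i : ℤ} (hi : 0 ≤ i) :
    coordH φ pp i = ∑ s, negMulLog (pp s) := by
  simp [coordH, Fintype.sum_sum_type, wt, hi, not_lt.2 hi]

lemma coordH_of_neg [Fintype Sm] {i : ℤ} (hi : i < 0) : coordH φ pp i = coordH φ pp (-1) := by
  simp [coordH, Fintype.sum_sum_type, wt, hi, not_le.2 hi]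

lemma IsProductMeasure.measureReal_window [Nonempty (Sm ⊕ Sp)] (hpp : ∀ s, 0 ≤ pp s)
    (hμ : IsProductMeasure φ pp μ) (I : Finset ℤ) (z : I → Sm ⊕ Sp) :
    μ.real (window I ⁻¹' {z}) = ∏ i : I, wt φ pp i (z i) := by
  obtain ⟨c, hc, h⟩ := window_preimage_singleton I z
  rw [h, measureReal_def, hμ, ENNReal.toReal_prod, ← Finset.prod_coe_sort]
  exact Finset.prod_congr rfl fun i _ => by
    rw [ENNReal.toReal_ofReal (wt_nonneg φ hpp _ _), hc]

lemma IsProductMeasure.measureReal_cyl [Nonempty (Sm ⊕ Sp)] (hpp : ∀ s, 0 ≤ pp s)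
    (hμ : IsProductMeasure φ pp μ) (i : ℤ) (s : Sm ⊕ Sp) :
    μ.real (cyl i s) = wt φ pp i s := by
  have h := hμ {i} fun _ => s
  simp only [Finset.mem_singleton, forall_eq, Finset.prod_singleton] at h
  rw [measureReal_def, cyl, h, ENNReal.toReal_ofReal (wt_nonneg φ hpp _ _)]

/-- The entropy of finitely many coordinates is the sum of their entropies. -/
lemma IsProductMeasure.varH_window [Fintype Sm] [Nonempty (Sm ⊕ Sp)] (hpp : ∀ s, 0 ≤ pp s)
    (hμ : IsProductMeasure φ pp μ) (I : Finset ℤ) :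
    varH μ (window I) = ∑ i ∈ I, coordH φ pp i := by
  have := hμ.isProbabilityMeasure
  have hcoord : ∀ i s, MeasurableSet ((fun x : ZipSpace Sm Sp => x.1 i) ⁻¹' {s}) :=
    fun i s => measurableSet_cyl i s
  calc varH μ (window I)
      = ∑ z : I → Sm ⊕ Sp, μ.real (window I ⁻¹' {z}) * ∑ i : I, -log (wt φ pp i (z i)) := by
        refine Finset.sum_congr rfl fun z _ => ?_
        rw [hμ.measureReal_window φ hpp]
        by_cases h : ∏ i : I, wt φ pp i (z i) = 0
        · rw [h, negMulLog_zero, zero_mul]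
        · rw [negMulLog, Real.log_prod fun i hi => Finset.prod_ne_zero_iff.1 h i hi,
            Finset.sum_neg_distrib]
          ring
    _ = ∫ x : ZipSpace Sm Sp, ∑ i : I, -log (wt φ pp i (x.1 i)) ∂μ :=
        (integral_comp_eq_sum μ (measurableSet_window_fiber I)
          fun z => ∑ i : I, -log (wt φ pp i (z i))).symm
    _ = ∑ i : I, coordH φ pp i := by
        rw [integral_finsetSum Finset.univ fun (i : I) _ => integrable_comp_of_finite μ (hcoord i)
          fun s => -log (wt φ pp i s)]
        refine Finset.sum_congr rfl fun i _ => ?_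
        rw [integral_comp_eq_sum μ (hcoord i) fun s => -log (wt φ pp i s), coordH]
        refine Finset.sum_congr rfl fun s _ => ?_
        have : μ.real ((fun x : ZipSpace Sm Sp => x.1 (i : ℤ)) ⁻¹' {s}) = wt φ pp i s :=
          hμ.measureReal_cyl φ hpp i s
        rw [negMulLog, this]
        ring
    _ = ∑ i ∈ I, coordH φ pp i := Finset.sum_coe_sort I _

end Zip

section Entropy

variable {Sm Sp : Type*} [Fintype Sm] [Fintype Sp] [DecidableEq Sm] [Nonempty (Sm ⊕ Sp)]
  (φ : Sp → Sm) {pp : Sp → ℝ} {μ : Measure (ZipSpace Sm Sp)}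

/-- Entropy rates of finite measurable partitions are at most the entropy of a coordinate. -/
lemma IsProductMeasure.partH_dynRefine_le (hpp : ∀ s, 0 ≤ pp s) (hμ : IsProductMeasure φ pp μ)
    {P : Set (Set (ZipSpace Sm Sp))} (hP : IsFinPart μ P) {ε : ℝ} (hε : 0 < ε) :
    ∃ C : ℝ, ∀ n : ℕ, partH μ (dynRefine (zipShift φ) P n) ≤
      n * (∑ s, negMulLog (pp s) + ε) + C := by
  classical
  have := hμ.isProbabilityMeasure
  obtain ⟨hfin, hmeas, hdisj, -⟩ := hP
  have := hfin.fintype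
  have hshift := hμ.measurePreserving φ hpp
  obtain ⟨η, hη0, hη1, hηε⟩ : ∃ η : ℝ, 0 < η ∧ η < 1 ∧ -log (1 - η) = ε / 2 :=
    ⟨1 - exp (-(ε / 2)), by
      have : exp (-(ε / 2)) < 1 := Real.exp_lt_one_iff.2 (by linarith)
      linarith, by linarith [Real.exp_pos (-(ε / 2))], by simp⟩
  set b : ℝ := log (Fintype.card (Set P) / η)
  have hb : 0 < b := Real.log_pos <| by
    rw [lt_div_iff₀ hη0, one_mul]
    exact hη1.trans_le (Nat.one_le_cast.2 Fintype.card_pos)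
  obtain ⟨m, Y, E, hY, hE, hEδ, hXY⟩ :=
    exists_finiteCoord_approx μ hfin hmeas (δ := ε / 2 / b) (by positivity)
  refine ⟨m * coordH φ pp (-1) + m * ∑ s, negMulLog (pp s), fun n => ?_⟩
  set I : Finset ℤ := Finset.Ico (-m : ℤ) 0 ∪ Finset.Ico 0 (n + m : ℤ) with hI
  set X : Fin n → ZipSpace Sm Sp → Set P := fun j x => {A | (zipShift φ)^[j] x ∈ (A : Set _)}
  have hX : ∀ j l, MeasurableSet (X j ⁻¹' {l}) := by
    intro j l
    have : X j ⁻¹' {l} = ⋂ A : P, {x | (zipShift φ)^[j] x ∈ (A : Set _) ↔ A ∈ l} := by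
      ext x
      simp only [X, Set.mem_preimage, Set.mem_singleton_iff, Set.ext_iff, Set.mem_iInter]
      rfl
    rw [this]
    refine MeasurableSet.iInter fun A => ?_
    have hA : MeasurableSet ((zipShift φ)^[j] ⁻¹' (A : Set _)) :=
      (measurable_zipShift φ).iterate j (hmeas A A.2)
    by_cases hl : A ∈ l
    · simp only [hl, iff_true]
      exact hA
    · simp only [hl, iff_false]
      exact hA.compl
  have hfactor : ∀ j : Fin n, ∃ y : (I → Sm ⊕ Sp) → Set P,
      (fun x => Y ((zipShift φ)^[j] x)) = y ∘ window I := by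
    intro j
    rw [← Function.factorsThrough_iff]
    intro x x' hxx'
    refine hY _ _ fun i hi => zipShift_iterate_congr φ j ?_
    have hij : i + (j : ℕ) ∈ I := by
      have := j.2
      rw [Finset.mem_Icc] at hi
      rw [hI, Finset.mem_union, Finset.mem_Ico, Finset.mem_Ico]
      omega
    exact congrFun hxx' ⟨_, hij⟩
  choose y hy using hfactor
  set W : ZipSpace Sm Sp → (I → Sm ⊕ Sp) × (Fin n → Set P) := fun x => (window I x, fun j => X j x)
  have hW : ∀ w, MeasurableSet (W ⁻¹' {w}) := by
    rintro ⟨z, l⟩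
    have : W ⁻¹' {(z, l)} = window I ⁻¹' {z} ∩ ⋂ j, X j ⁻¹' {l j} := by
      ext x; simp [W, funext_iff]
    rw [this]
    exact (measurableSet_window_fiber I z).inter (MeasurableSet.iInter fun j => hX j _)
  have hpart : partH μ (dynRefine (zipShift φ) P n) ≤ varH μ W :=
    partH_le_varH μ hW (pairwise_disjoint_dynRefine _ hdisj n) fun A hA x x' hxx' =>
      mem_of_mem_dynRefine _ hA fun j hj => congrFun (congrArg Prod.snd hxx') ⟨j, hj⟩
  have herr : ∀ j : Fin n, μ.real {x | X j x ≠ y j (window I x)} ≤ ε / 2 / b := fun j => by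
    refine le_trans (measureReal_mono ?_) (le_of_eq_of_le
      ((hshift.iterate j).measureReal_preimage hE.nullMeasurableSet) hEδ)
    intro x hx
    by_contra hxE
    exact hx ((hXY _ hxE).trans (congrFun (hy j) x))
  have hwin : varH μ (window I : ZipSpace Sm Sp → _) =
      m * coordH φ pp (-1) + (n + m) * ∑ s, negMulLog (pp s) := by
    rw [hμ.varH_window φ hpp, hI, Finset.sum_union (Finset.Ico_disjoint_Ico_consecutive _ _ _),
      Finset.sum_congr rfl fun i hi => coordH_of_neg φ (Finset.mem_Ico.1 hi).2,
      Finset.sum_congr (s₁ := Finset.Ico 0 _) rfl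
        fun i hi => coordH_of_nonneg φ (Finset.mem_Ico.1 hi).1]
    have h : ((n : ℤ) + m).toNat = n + m := by omega
    simp [h]
  calc partH μ (dynRefine (zipShift φ) P n) ≤ varH μ W := hpart
    _ ≤ varH μ (window I : ZipSpace Sm Sp → _) +
        ∑ j : Fin n, (-log (1 - η) + μ.real {x | X j x ≠ y j (window I x)} * b) :=
        varH_prod_le μ (measurableSet_window_fiber I) hX y hη0 hη1
    _ ≤ (m * coordH φ pp (-1) + (n + m) * ∑ s, negMulLog (pp s)) + ∑ _j : Fin n, ε := by
        rw [hwin]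
        gcongr with j
        have h1 := mul_le_mul_of_nonneg_right (herr j) hb.le
        rw [div_mul_cancel₀ _ hb.ne'] at h1
        linarith
    _ = _ := by
        simp only [Finset.sum_const, Finset.card_univ, Fintype.card_fin, nsmul_eq_mul]
        ring

lemma IsProductMeasure.isFinPart_cylPart (hμ : IsProductMeasure φ pp μ) (i : ℤ) :
    IsFinPart μ (cylPart i) := by
  have := hμ.isProbabilityMeasure
  refine ⟨?_, ?_, ?_, ?_⟩
  · refine (Set.finite_range (cyl i)).subset ?_
    rintro _ ⟨s, -, rfl⟩
    exact ⟨s, rfl⟩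
  · rintro _ ⟨s, -, rfl⟩
    exact measurableSet_cyl i s
  · rintro _ ⟨s, -, rfl⟩ _ ⟨t, -, rfl⟩ h
    exact cyl_disjoint fun hst => h (by rw [hst])
  · have : ⋃₀ cylPart i = (Set.univ : Set (ZipSpace Sm Sp)) :=
      Set.eq_univ_of_forall fun x => ⟨_, ⟨x.1 i, x.2 i, rfl⟩, rfl⟩
    rw [this, measure_univ]

lemma IsProductMeasure.partH_cylPart (hpp : ∀ s, 0 ≤ pp s) (hμ : IsProductMeasure φ pp μ) :
    partH μ (cylPart 0) = ∑ s, negMulLog (pp s) := by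
  rw [partH_eq_varH μ (W := fun x : ZipSpace Sm Sp => x.1 0), ← coordH_of_nonneg φ le_rfl]
  · exact Finset.sum_congr rfl fun s _ => congrArg _ (hμ.measureReal_cyl φ hpp 0 s)
  · rintro _ ⟨s, -, rfl⟩
    exact ⟨s, rfl⟩
  · exact fun x => ⟨x.1 0, x.2 0, rfl⟩

lemma IsProductMeasure.partH_dynRefine_cylPart (hpp : ∀ s, 0 ≤ pp s)
    (hμ : IsProductMeasure φ pp μ) (n : ℕ) :
    partH μ (dynRefine (zipShift φ) (cylPart 0) n) = n * ∑ s, negMulLog (pp s) := by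
  set I : Finset ℤ := (Finset.range n).map Nat.castEmbedding with hI
  have hpre : ∀ (j : ℕ) s, (zipShift φ)^[j] ⁻¹' cyl 0 s = cyl j s := fun j s => by
    ext x
    simp only [cyl, Set.mem_preimage, Set.mem_ofPred_eq, zipShift_iterate_apply_zero]
  have hfib : ∀ x : ZipSpace Sm Sp, window I ⁻¹' {window I x} =
      ⋂ j ∈ Set.Iio n, cyl (j : ℤ) (x.1 j) := by
    intro x
    ext y
    simp only [Set.mem_preimage, Set.mem_singleton_iff, Set.mem_iInter, funext_iff, window,
      Subtype.forall]
    rw [hI]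
    simp only [Finset.forall_mem_map, Finset.mem_range]
    rfl
  rw [partH_eq_varH μ (W := window I), hμ.varH_window φ hpp, hI, Finset.sum_map]
  · have h : ∀ i ∈ Finset.range n, coordH φ pp (Nat.castEmbedding i) = ∑ s, negMulLog (pp s) :=
      fun i _ => coordH_of_nonneg φ (Int.natCast_nonneg i)
    rw [Finset.sum_congr rfl h]
    simp
  · rintro A ⟨⟨x, hx⟩, g, hg, rfl⟩
    refine ⟨window I x, ?_⟩
    rw [hfib]
    refine Set.iInter₂_congr fun j hj => ?_
    obtain ⟨_, ⟨s, -, rfl⟩, hB⟩ := hg j hj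
    have hxj : x ∈ g j := Set.mem_iInter₂.1 hx j hj
    rw [← hB, hpre] at hxj ⊢
    rw [show x.1 j = s from hxj]
  · intro x
    refine ⟨⟨x, rfl⟩, fun j => cyl (j : ℤ) (x.1 j), fun j _ => ?_, hfib x⟩
    refine ⟨cyl 0 (x.1 j), ⟨x.1 j, ?_, rfl⟩, hpre j _⟩
    have hj := x.2 j
    rw [Adm, if_neg (not_lt.2 (Int.natCast_nonneg j))] at hj
    simpa [Adm] using hj

end Entropy

end ZipShiftPaper

open ZipShiftPaper


/-- the Kolmogorov–Sinai entropy of the zip shift is `H_μ(𝒞_0)`,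
the Shannon entropy of `p⁺`. -/
theorem statement11 {Sm Sp : Type*} [Fintype Sm] [Fintype Sp] [Nonempty Sm] [Nonempty Sp]
    [DecidableEq Sm]
    (φ : Sp → Sm) (hφ : Function.Surjective φ)
    (pp : Sp → ℝ) (hpp : ∀ s, 0 ≤ pp s) (hsum : ∑ s, pp s = 1)
    (μ : Measure (ZipSpace Sm Sp)) (hμ : IsProductMeasure φ pp μ) :
    ksEntropy μ (zipShift φ) = partH μ (cylPart 0) ∧
    partH μ (cylPart 0) = ∑ s : Sp, -(pp s) * Real.log (pp s) := by
  have hH := hμ.partH_cylPart φ hpp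
  refine ⟨?_, by simpa only [negMulLog] using hH⟩
  rw [hH]
  refine IsGreatest.csSup_eq ⟨⟨cylPart 0, hμ.isFinPart_cylPart φ 0, ?_⟩, ?_⟩
  · refine tendsto_const_nhds.congr' ?_
    filter_upwards [eventually_gt_atTop 0] with n hn
    have : (n : ℝ) ≠ 0 := by positivity
    rw [hμ.partH_dynRefine_cylPart φ hpp]
    field_simp
  · rintro h ⟨P, hP, hlim⟩
    refine le_of_forall_pos_le_add fun ε hε => ?_
    obtain ⟨C, hC⟩ := hμ.partH_dynRefine_le φ hpp hP hε
    have hbound : Tendsto (fun n : ℕ => ∑ s, negMulLog (pp s) + ε + C / n) atTop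
        (nhds (∑ s, negMulLog (pp s) + ε)) := by
      simpa using tendsto_const_nhds.add (tendsto_const_div_atTop_nhds_zero_nat C)
    refine le_of_tendsto_of_tendsto hlim hbound ?_
    filter_upwards [eventually_gt_atTop 0] with n hn
    have hn' : (0 : ℝ) < n := by positivity
    rw [div_le_iff₀ hn', add_mul, div_mul_cancel₀ _ hn'.ne', mul_comm _ (n : ℝ)]
    exact hC n
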